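/- Let a and c be integers with gcd(a,c) = 1 and c = r·q₁·q₂ for some positive integer r. Then there exists z ∈ ℤ[χ₁,χ₂] such that S_{χ₁,χ₂}(a,c) = z/(r·q₁); equivalently, r·q₁·S_{χ₁,χ₂}(a,c) lies in F_{χ₁,χ₂} and is integral over ℤ. -/

import Mathlib

open Complex Finset
open scoped Classical

/-- The sawtooth function `B₁(x)`: `0` if `x ∈ ℤ`, and `x - ⌊x⌋ - 1/2` otherwise. -/
noncomputable def sawtooth (x : ℝ) : ℝ :=
  if ∃ n : ℤ, (n : ℝ) = x then 0 else Int.fract x - 1 / 2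

/-- The newform Dedekind sum `S_{χ₁,χ₂}(a, c)` associated to Dirichlet characters
`χ₁ mod q₁` and `χ₂ mod q₂`. -/
noncomputable def newformDedekindSum {q₁ q₂ : ℕ} (χ₁ : DirichletCharacter ℂ q₁)
    (χ₂ : DirichletCharacter ℂ q₂) (a c : ℤ) : ℂ :=
  ∑ j ∈ Finset.range c.toNat, ∑ n ∈ Finset.range q₁,
    (starRingEnd ℂ) (χ₂ (j : ZMod q₂)) * (starRingEnd ℂ) (χ₁ (n : ZMod q₁)) *
      (sawtooth ((j : ℝ) / (c : ℝ)) : ℂ) *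
      (sawtooth ((n : ℝ) / (q₁ : ℝ) + (a : ℝ) * (j : ℝ) / (c : ℝ)) : ℂ)

/-- The newform Dedekind sum of a matrix `γ = (a, b; c, d) ∈ SL₂(ℤ)`:
it is `S_{χ₁,χ₂}(a, c)` if `c ≥ 1`, `S_{χ₁,χ₂}(-γ)` if `c ≤ -1`, and `0` if `c = 0`. -/
noncomputable def newformDedekindSumSL {q₁ q₂ : ℕ} (χ₁ : DirichletCharacter ℂ q₁)
    (χ₂ : DirichletCharacter ℂ q₂) (γ : Matrix.SpecialLinearGroup (Fin 2) ℤ) : ℂ :=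
  if γ.1 1 0 = 0 then 0
  else if 1 ≤ γ.1 1 0 then newformDedekindSum χ₁ χ₂ (γ.1 0 0) (γ.1 1 0)
  else newformDedekindSum χ₁ χ₂ (-(γ.1 0 0)) (-(γ.1 1 0))

/-- Membership in `Γ₀(N)`: the lower-left entry is divisible by `N`. -/
def InGamma0 (N : ℕ) (γ : Matrix.SpecialLinearGroup (Fin 2) ℤ) : Prop :=
  (N : ℤ) ∣ γ.1 1 0

/-- Membership in `Γ₁(N)`: lower-left entry divisible by `N` and both diagonal
entries congruent to `1` mod `N`. -/
def InGamma1 (N : ℕ) (γ : Matrix.SpecialLinearGroup (Fin 2) ℤ) : Prop :=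
  InGamma0 N γ ∧ (N : ℤ) ∣ (γ.1 0 0 - 1) ∧ (N : ℤ) ∣ (γ.1 1 1 - 1)

/-- `x` lies in the ring of integers `ℤ[χ₁,χ₂]` of the field `F_{χ₁,χ₂} ⊆ ℂ` generated
by the values of `χ₁` and `χ₂`: `x` lies in the subfield of `ℂ` generated by the values
of the characters and is integral over `ℤ`. -/
def InRingOfIntegers {q₁ q₂ : ℕ} (χ₁ : DirichletCharacter ℂ q₁)
    (χ₂ : DirichletCharacter ℂ q₂) (x : ℂ) : Prop :=
  x ∈ Subfield.closure (Set.range (χ₁ : ZMod q₁ → ℂ) ∪ Set.range (χ₂ : ZMod q₂ → ℂ)) ∧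
    IsIntegral ℤ x

theorem sum_range_natCast_zmod {M : Type*} [AddCommMonoid M] (N : ℕ) [NeZero N] (h : ZMod N → M) :
    ∑ k ∈ Finset.range N, h (k : ZMod N) = ∑ z : ZMod N, h z := by
  refine Finset.sum_bij' (fun k _ => (k : ZMod N)) (fun z _ => z.val) ?_ ?_ ?_ ?_ ?_
  · simp
  · intro z _
    simpa using ZMod.val_lt z
  · intro k hk
    simpa using ZMod.val_cast_of_lt (Finset.mem_range.mp hk)
  · simp
  · simp

/-- Summing an `N`-periodic function over a period is invariant under
`k ↦ a * k + m` with `a` coprime to `N`. -/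
theorem sum_range_affine_of_periodic {M : Type*} [AddCommMonoid M] (N : ℕ) [NeZero N]
    (g : ℤ → M) (hg : Function.Periodic g (N : ℤ)) (a m : ℤ) (ha : IsCoprime a (N : ℤ)) :
    ∑ k ∈ Finset.range N, g (a * k + m) = ∑ k ∈ Finset.range N, g k := by
  have hlift (k : ℤ) : g k = g (((k : ZMod N).val : ℕ) : ℤ) := by
    rw [ZMod.val_intCast]
    conv_lhs => rw [← Int.emod_add_mul_ediv k N, mul_comm]
    exact hg.int_mul _ _
  have hinj : Function.Injective fun z : ZMod N => (a : ZMod N) * z + (m : ZMod N) := by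
    intro x y hxy
    obtain ⟨u, v, huv⟩ := ha
    have hu : (u : ZMod N) * (a : ZMod N) = 1 := by
      have := congrArg (Int.cast : ℤ → ZMod N) huv
      simpa using this
    have h := add_right_cancel hxy
    calc x = (u * a : ZMod N) * x := by rw [hu, one_mul]
      _ = (u * a : ZMod N) * y := by rw [mul_assoc, h, mul_assoc]
      _ = y := by rw [hu, one_mul]
  have hbij := Finite.injective_iff_bijective.mp hinj
  calc ∑ k ∈ Finset.range N, g (a * k + m)
      = ∑ k ∈ Finset.range N, g (((a : ZMod N) * (k : ZMod N) + (m : ZMod N)).val : ℤ) := by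
        refine Finset.sum_congr rfl fun k _ => ?_
        rw [hlift]
        push_cast
        rfl
    _ = ∑ z : ZMod N, g (((a : ZMod N) * z + (m : ZMod N)).val : ℤ) :=
        sum_range_natCast_zmod N fun z => g (((a : ZMod N) * z + (m : ZMod N)).val : ℤ)
    _ = ∑ z : ZMod N, g (z.val : ℤ) := hbij.sum_comp fun z => g (z.val : ℤ)
    _ = ∑ k ∈ Finset.range N, g (((k : ℕ) : ZMod N).val : ℤ) :=
        (sum_range_natCast_zmod N fun z => g (z.val : ℤ)).symm
    _ = ∑ k ∈ Finset.range N, g k := by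
        refine Finset.sum_congr rfl fun k _ => ?_
        rw [hlift k]
        simp

theorem sum_range_fract_add_div (N : ℕ) [NeZero N] (a m : ℤ) (ha : IsCoprime a (N : ℤ)) (x : ℝ) :
    ∑ k ∈ Finset.range N, Int.fract (x + (a * k + m : ℤ) / (N : ℝ)) =
      ∑ k ∈ Finset.range N, Int.fract (x + (k : ℝ) / (N : ℝ)) := by
  have hN : (N : ℝ) ≠ 0 := NeZero.ne _
  have := sum_range_affine_of_periodic N (fun k : ℤ => Int.fract (x + (k : ℝ) / (N : ℝ)))
    (fun k => by
      have : x + ((k + (N : ℤ) : ℤ) : ℝ) / (N : ℝ) = x + (k : ℝ) / N + 1 := by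
        push_cast
        field_simp
        ring
      simp only [this, Int.fract_add_one]) a m ha
  simpa using this

theorem sum_range_mul_eq {M : Type*} [AddCommMonoid M] (N q : ℕ) (f : ℕ → M) :
    ∑ j ∈ Finset.range (N * q), f j =
      ∑ k ∈ Finset.range N, ∑ i ∈ Finset.range q, f (i + q * k) := by
  induction N with
  | zero => simp
  | succ N ih =>
    rw [Nat.succ_mul, Finset.sum_range_add, ih, Finset.sum_range_succ]
    congr 1
    refine Finset.sum_congr rfl fun i _ => ?_
    rw [add_comm, mul_comm]

theorem sum_range_conj_dirichletCharacter {q : ℕ} (hq : 0 < q) (χ : DirichletCharacter ℂ q)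
    (hχ : χ ≠ 1) : ∑ n ∈ Finset.range q, (starRingEnd ℂ) (χ (n : ZMod q)) = 0 := by
  have : NeZero q := ⟨hq.ne'⟩
  rw [← map_sum, sum_range_natCast_zmod q fun z => χ z, MulChar.sum_eq_zero_of_ne_one hχ, map_zero]

theorem conj_dirichletCharacter_apply {q : ℕ} [NeZero q] (χ : DirichletCharacter ℂ q)
    (x : ZMod q) : (starRingEnd ℂ) (χ x) = χ (Ring.inverse x) := by
  rw [starRingEnd_apply, MulChar.star_apply', MulChar.inv_apply]

theorem isIntegral_dirichletCharacter_apply {q : ℕ} (hq : 0 < q) (χ : DirichletCharacter ℂ q)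
    (x : ZMod q) : IsIntegral ℤ (χ x) := by
  have : NeZero q := ⟨hq.ne'⟩
  by_cases hx : IsUnit x
  · obtain ⟨n, hn, h⟩ := (isOfFinOrder_of_finite hx.unit).exists_pow_eq_one
    refine IsIntegral.of_pow hn ?_
    have hx' : x ^ n = 1 := by simpa using congrArg Units.val h
    rw [← map_pow, hx', map_one]
    exact isIntegral_one
  · rw [χ.map_nonunit hx]
    exact isIntegral_zero

theorem sawtooth_of_forall_ne {x : ℝ} (hx : ∀ n : ℤ, (n : ℝ) ≠ x) :
    sawtooth x = Int.fract x - 1 / 2 :=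
  if_neg fun ⟨n, hn⟩ => hx n hn

theorem inRingOfIntegers_sum {q₁ q₂ : ℕ} (χ₁ : DirichletCharacter ℂ q₁)
    (χ₂ : DirichletCharacter ℂ q₂) {ι : Type*} (s : Finset ι) (f : ι → ℂ)
    (h : ∀ i ∈ s, InRingOfIntegers χ₁ χ₂ (f i)) : InRingOfIntegers χ₁ χ₂ (∑ i ∈ s, f i) :=
  ⟨sum_mem fun i hi => (h i hi).1, IsIntegral.sum _ fun i hi => (h i hi).2⟩

theorem inRingOfIntegers_conj_mul_conj_mul_intCast {q₁ q₂ : ℕ} (hq₁ : 0 < q₁) (hq₂ : 0 < q₂)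
    (χ₁ : DirichletCharacter ℂ q₁) (χ₂ : DirichletCharacter ℂ q₂)
    (y : ZMod q₂) (x : ZMod q₁) (m : ℤ) :
    InRingOfIntegers χ₁ χ₂ ((starRingEnd ℂ) (χ₂ y) * (starRingEnd ℂ) (χ₁ x) * (m : ℂ)) := by
  have : NeZero q₁ := ⟨hq₁.ne'⟩
  have : NeZero q₂ := ⟨hq₂.ne'⟩
  rw [conj_dirichletCharacter_apply, conj_dirichletCharacter_apply]
  refine ⟨mul_mem (mul_mem ?_ ?_) (intCast_mem _ _), ?_⟩
  · exact Subfield.subset_closure (Or.inr ⟨_, rfl⟩)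
  · exact Subfield.subset_closure (Or.inl ⟨_, rfl⟩)
  · exact ((isIntegral_dirichletCharacter_apply hq₂ χ₂ _).mul
      (isIntegral_dirichletCharacter_apply hq₁ χ₁ _)).mul (isIntegral_algebraMap (A := ℂ) (x := m))

/-- If `q₂ ∣ c` and `a` is coprime to `c`, no argument of the sawtooth function in a nonzero term
of the newform Dedekind sum is an integer. -/
theorem newformDedekindSum_eq_sum_fract {q₁ q₂ R : ℕ} (hq₁ : 0 < q₁) (hq₂ : 0 < q₂) (hR : 0 < R)
    (χ₁ : DirichletCharacter ℂ q₁) (χ₂ : DirichletCharacter ℂ q₂) (hχ₂ : χ₂ ≠ 1)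
    (a : ℤ) (hcop : IsCoprime a ((R * q₁ * q₂ : ℕ) : ℤ)) :
    newformDedekindSum χ₁ χ₂ a ((R * q₁ * q₂ : ℕ) : ℤ) =
      ∑ j ∈ Finset.range (R * q₁ * q₂), ∑ n ∈ Finset.range q₁,
        (starRingEnd ℂ) (χ₂ (j : ZMod q₂)) * (starRingEnd ℂ) (χ₁ (n : ZMod q₁)) *
          ((j : ℂ) / ((R * q₁ * q₂ : ℕ) : ℂ) - 1 / 2) *
          (((Int.fract ((n : ℝ) / (q₁ : ℝ) +
            (a : ℝ) * (j : ℝ) / ((R * q₁ * q₂ : ℕ) : ℝ)) : ℝ) : ℂ) - 1 / 2) := by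
  unfold newformDedekindSum
  rw [Int.toNat_natCast]
  refine Finset.sum_congr rfl fun j hj => Finset.sum_congr rfl fun n _ => ?_
  by_cases hd : (q₂ : ℤ) ∣ (j : ℤ)
  · have h0 : χ₂ (j : ZMod q₂) = 0 := by
      rw [(ZMod.natCast_eq_zero_iff j q₂).mpr (by exact_mod_cast hd)]
      refine χ₂.map_nonunit fun hu => hχ₂ ?_
      have : Subsingleton (ZMod q₂) := subsingleton_of_zero_eq_one (isUnit_zero_iff.mp hu)
      exact MulChar.ext fun u => by rw [Subsingleton.elim u 1]; simp
    simp [h0]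
  have hq₁' : (q₁ : ℝ) ≠ 0 := by exact_mod_cast hq₁.ne'
  have hq₂' : (q₂ : ℝ) ≠ 0 := by exact_mod_cast hq₂.ne'
  have hR' : (R : ℝ) ≠ 0 := by exact_mod_cast hR.ne'
  have hcop₂ : IsCoprime (q₂ : ℤ) a :=
    (hcop.of_isCoprime_of_dvd_right ⟨(R * q₁ : ℕ), by push_cast; ring⟩).symm
  have h₁ : ∀ m : ℤ, (m : ℝ) ≠ (j : ℝ) / (((R * q₁ * q₂ : ℕ) : ℤ) : ℝ) := by
    intro m hm
    apply hd
    push_cast at hm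
    field_simp at hm
    exact ⟨m * R * q₁, by exact_mod_cast (by linarith : (j : ℝ) = q₂ * (m * R * q₁))⟩
  have h₂ : ∀ m : ℤ, (m : ℝ) ≠ (n : ℝ) / (q₁ : ℝ) +
      (a : ℝ) * (j : ℝ) / (((R * q₁ * q₂ : ℕ) : ℤ) : ℝ) := by
    intro m hm
    apply hd
    push_cast at hm
    field_simp at hm
    refine hcop₂.dvd_of_dvd_mul_left ⟨m * R * q₁ - n * R, ?_⟩
    exact_mod_cast (by linarith : (a : ℝ) * j = q₂ * (m * R * q₁ - n * R))
  rw [sawtooth_of_forall_ne h₁, sawtooth_of_forall_ne h₂]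
  have hfr : Int.fract ((j : ℝ) / (((R * q₁ * q₂ : ℕ) : ℤ) : ℝ)) =
      (j : ℝ) / (((R * q₁ * q₂ : ℕ) : ℤ) : ℝ) := by
    rw [Int.fract_eq_self]
    have hj' : (j : ℝ) < ((R * q₁ * q₂ : ℕ) : ℝ) := by exact_mod_cast Finset.mem_range.mp hj
    rw [Int.cast_natCast]
    exact ⟨by positivity, (div_lt_one (lt_of_le_of_lt (Nat.cast_nonneg j) hj')).mpr hj'⟩
  rw [hfr]
  push_cast
  rfl

theorem sum_conj_mul_sum_fract_eq_zero {q₁ q₂ R : ℕ} (hq₁ : 0 < q₁) (hq₂ : 0 < q₂) (hR : 0 < R)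
    (χ₁ : DirichletCharacter ℂ q₁) (hχ₁ : χ₁ ≠ 1)
    (a : ℤ) (hcop : IsCoprime a ((R * q₁ * q₂ : ℕ) : ℤ)) (i : ℕ) :
    ∑ k ∈ Finset.range (R * q₁), ∑ n ∈ Finset.range q₁,
      (starRingEnd ℂ) (χ₁ (n : ZMod q₁)) *
        ((Int.fract ((n : ℝ) / (q₁ : ℝ) +
          (a : ℝ) * ((i + q₂ * k : ℕ) : ℝ) / ((R * q₁ * q₂ : ℕ) : ℝ)) : ℝ) : ℂ) = 0 := by
  have hN : 0 < R * q₁ := by positivity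
  have : NeZero (R * q₁) := ⟨hN.ne'⟩
  have hq₁' : (q₁ : ℝ) ≠ 0 := by exact_mod_cast hq₁.ne'
  have hq₂' : (q₂ : ℝ) ≠ 0 := by exact_mod_cast hq₂.ne'
  have hR' : (R : ℝ) ≠ 0 := by exact_mod_cast hR.ne'
  have hcop₁ : IsCoprime a ((R * q₁ : ℕ) : ℤ) :=
    hcop.of_isCoprime_of_dvd_right ⟨q₂, by push_cast; ring⟩
  set x : ℝ := (a : ℝ) * i / ((R * q₁ * q₂ : ℕ) : ℝ)
  have key (n : ℕ) : ∑ k ∈ Finset.range (R * q₁), Int.fract ((n : ℝ) / (q₁ : ℝ) +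
      (a : ℝ) * ((i + q₂ * k : ℕ) : ℝ) / ((R * q₁ * q₂ : ℕ) : ℝ)) =
      ∑ k ∈ Finset.range (R * q₁), Int.fract (x + (k : ℝ) / ((R * q₁ : ℕ) : ℝ)) := by
    rw [← sum_range_fract_add_div (R * q₁) a (n * R) hcop₁ x]
    refine Finset.sum_congr rfl fun k _ => ?_
    congr 1
    simp only [x]
    push_cast
    field_simp
    ring
  rw [Finset.sum_comm]
  simp_rw [← Finset.mul_sum, ← Complex.ofReal_sum, key]
  rw [← Finset.sum_mul, sum_range_conj_dirichletCharacter hq₁ χ₁ hχ₁, zero_mul]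

theorem mul_newformDedekindSum_eq_sum_floor {q₁ q₂ R : ℕ} (hq₁ : 0 < q₁) (hq₂ : 0 < q₂)
    (hR : 0 < R) (χ₁ : DirichletCharacter ℂ q₁) (χ₂ : DirichletCharacter ℂ q₂)
    (hχ₁ : χ₁ ≠ 1) (hχ₂ : χ₂ ≠ 1) (a : ℤ) (hcop : IsCoprime a ((R * q₁ * q₂ : ℕ) : ℤ)) :
    ((R * q₁ : ℕ) : ℂ) * newformDedekindSum χ₁ χ₂ a ((R * q₁ * q₂ : ℕ) : ℤ) =
      ∑ k ∈ Finset.range (R * q₁), ∑ i ∈ Finset.range q₂, ∑ n ∈ Finset.range q₁,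
        (starRingEnd ℂ) (χ₂ (i : ZMod q₂)) * (starRingEnd ℂ) (χ₁ (n : ZMod q₁)) *
          ((-(k * ⌊(n : ℝ) / (q₁ : ℝ) +
            (a : ℝ) * ((i + q₂ * k : ℕ) : ℝ) / ((R * q₁ * q₂ : ℕ) : ℝ)⌋) : ℤ) : ℂ) := by
  have hq₁' : (q₁ : ℂ) ≠ 0 := by exact_mod_cast hq₁.ne'
  have hq₂' : (q₂ : ℂ) ≠ 0 := by exact_mod_cast hq₂.ne'
  have hR' : (R : ℂ) ≠ 0 := by exact_mod_cast hR.ne'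
  rw [newformDedekindSum_eq_sum_fract hq₁ hq₂ hR χ₁ χ₂ hχ₂ a hcop, sum_range_mul_eq]
  set ψ₁ : ℕ → ℂ := fun n => (starRingEnd ℂ) (χ₁ (n : ZMod q₁)) with hψ₁
  set ψ₂ : ℕ → ℂ := fun i => (starRingEnd ℂ) (χ₂ (i : ZMod q₂)) with hψ₂
  have hs₁ : ∑ n ∈ Finset.range q₁, ψ₁ n = 0 := sum_range_conj_dirichletCharacter hq₁ χ₁ hχ₁
  have hs₂ : ∑ i ∈ Finset.range q₂, ψ₂ i = 0 := sum_range_conj_dirichletCharacter hq₂ χ₂ hχ₂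
  set y : ℕ → ℕ → ℕ → ℝ := fun k i n => (n : ℝ) / (q₁ : ℝ) +
    (a : ℝ) * ((i + q₂ * k : ℕ) : ℝ) / ((R * q₁ * q₂ : ℕ) : ℝ) with hy
  have hfract (i : ℕ) : ∑ k ∈ Finset.range (R * q₁), ∑ n ∈ Finset.range q₁,
      ψ₁ n * ((Int.fract (y k i n) : ℝ) : ℂ) = 0 :=
    sum_conj_mul_sum_fract_eq_zero hq₁ hq₂ hR χ₁ hχ₁ a hcop i
  let α : ℕ → ℂ := fun i => i / q₂ - (R * q₁) / 2
  let β : ℕ → ℕ → ℂ := fun k i => k * (a * (i + q₂ * k) / (R * q₁ * q₂)) - (k + α i) / 2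
  have hterm (k i n : ℕ) :
      ((R * q₁ : ℕ) : ℂ) * ((starRingEnd ℂ) (χ₂ ((i + q₂ * k : ℕ) : ZMod q₂)) * ψ₁ n *
        (((i + q₂ * k : ℕ) : ℂ) / ((R * q₁ * q₂ : ℕ) : ℂ) - 1 / 2) *
        (((Int.fract (y k i n) : ℝ) : ℂ) - 1 / 2)) =
      ψ₂ i * ψ₁ n * ((-(k * ⌊y k i n⌋) : ℤ) : ℂ) + ψ₂ i * (ψ₁ n * (k * (n / q₁))) +
        ψ₁ n * (ψ₂ i * β k i) + ψ₂ i * α i * (ψ₁ n * ((Int.fract (y k i n) : ℝ) : ℂ)) := by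
    have hχ : (starRingEnd ℂ) (χ₂ ((i + q₂ * k : ℕ) : ZMod q₂)) = ψ₂ i := by simp [hψ₂]
    have hfl : ((⌊y k i n⌋ : ℤ) : ℂ) = (n : ℂ) / q₁ + a * (i + q₂ * k) / (R * q₁ * q₂) -
        ((Int.fract (y k i n) : ℝ) : ℂ) := by
      have h := congrArg (Complex.ofReal) (Int.floor_add_fract (y k i n))
      rw [Complex.ofReal_add, Complex.ofReal_intCast] at h
      rw [eq_sub_iff_add_eq, h]
      simp [hy]
    rw [hχ]
    push_cast
    rw [hfl]
    simp only [α, β]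
    field_simp
    ring
  have h₂ : ∑ k ∈ Finset.range (R * q₁), ∑ i ∈ Finset.range q₂, ∑ n ∈ Finset.range q₁,
      ψ₂ i * (ψ₁ n * (k * (n / q₁) : ℂ)) = 0 := by
    simp_rw [← Finset.mul_sum, ← Finset.sum_mul, hs₂]
    simp
  have h₃ : ∑ k ∈ Finset.range (R * q₁), ∑ i ∈ Finset.range q₂, ∑ n ∈ Finset.range q₁,
      ψ₁ n * (ψ₂ i * β k i) = 0 := by
    simp_rw [← Finset.sum_mul, hs₁]
    simp
  have h₄ : ∑ k ∈ Finset.range (R * q₁), ∑ i ∈ Finset.range q₂, ∑ n ∈ Finset.range q₁,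
      ψ₂ i * α i * (ψ₁ n * ((Int.fract (y k i n) : ℝ) : ℂ)) = 0 := by
    rw [Finset.sum_comm]
    simp_rw [← Finset.mul_sum, hfract]
    simp
  simp_rw [Finset.mul_sum]
  calc _ = _ := Finset.sum_congr rfl fun k _ => Finset.sum_congr rfl fun i _ =>
        Finset.sum_congr rfl fun n _ => hterm k i n
    _ = _ := by
      simp_rw [Finset.sum_add_distrib]
      rw [h₂, h₃, h₄, add_zero, add_zero, add_zero]

theorem newform_dedekind_sum_denominator_rq1 {q₁ q₂ : ℕ} (hq₁ : 0 < q₁) (hq₂ : 0 < q₂)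
    (χ₁ : DirichletCharacter ℂ q₁) (χ₂ : DirichletCharacter ℂ q₂)
    (hχ₁ : χ₁ ≠ 1) (hχ₂ : χ₂ ≠ 1) (hp₁ : χ₁.IsPrimitive) (hp₂ : χ₂.IsPrimitive)
    (hpar : χ₁ (-1) * χ₂ (-1) = 1)
    (a c r : ℤ) (hr : 0 < r) (hc : c = r * ((q₁ : ℤ) * (q₂ : ℤ))) (hcop : IsCoprime a c) :
    ∃ z : ℂ, InRingOfIntegers χ₁ χ₂ z ∧
      newformDedekindSum χ₁ χ₂ a c = z / ((r : ℂ) * (q₁ : ℂ)) := by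
  lift r to ℕ using hr.le with R
  have hR : 0 < R := by exact_mod_cast hr
  obtain rfl : c = ((R * q₁ * q₂ : ℕ) : ℤ) := by
    rw [hc]
    push_cast
    ring
  refine ⟨((R * q₁ : ℕ) : ℂ) * newformDedekindSum χ₁ χ₂ a ((R * q₁ * q₂ : ℕ) : ℤ), ?_, ?_⟩
  · rw [mul_newformDedekindSum_eq_sum_floor hq₁ hq₂ hR χ₁ χ₂ hχ₁ hχ₂ a hcop]
    exact inRingOfIntegers_sum _ _ _ _ fun k _ => inRingOfIntegers_sum _ _ _ _ fun i _ =>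
      inRingOfIntegers_sum _ _ _ _ fun n _ =>
        inRingOfIntegers_conj_mul_conj_mul_intCast hq₁ hq₂ χ₁ χ₂ _ _ _
  · have hq₁' : (q₁ : ℂ) ≠ 0 := by exact_mod_cast hq₁.ne'
    have hR' : (R : ℂ) ≠ 0 := by exact_mod_cast hR.ne'
    push_cast
    field_simp
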